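/- Spectral Palm inversion: Let Y be a tail process with index α > 0 and finitely many exceedance-points (i.e. Y is a random element of ℝ₀^{ℤ^d} satisfying the tail-process identity, |Y_0| is Pareto(α)-distributed and independent of the spectral process Θ = Y/|Y_0|, and P(Θ ∈ l₀) = 1), set ϑ := E[1/|e(Y)|], and let Q = (Q_i)_{i∈ℤ^d} be any representative of the anchored spectral tail process. Then for every measurable h : l₀ → [0,∞): E[h(Θ)] = ϑ · E[Σ_{k∈ℤ^d} h(θ_k Q / |Q_k|) |Q_k|^α], where the k-th summand is understood to be zero whenever Q_k = 0. -/

import Mathlib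

open MeasureTheory ENNReal Filter ProbabilityTheory

noncomputable section

/-- The space `ℝ^{ℤ^d}` of real-valued fields indexed by `ℤ^d`. -/
abbrev RField (d : ℕ) := (Fin d → ℤ) → ℝ

variable {d : ℕ}

/-- Shift operator: `shift k x = (x_{i+k})_i`, i.e. it moves the origin to `k`. -/
def shift (k : Fin d → ℤ) (x : RField d) : RField d := fun i => x (i + k)

/-- The set of exceedance-points of `x`. -/
def excSet (x : RField d) : Set (Fin d → ℤ) := {k | 1 < |x k|}

open Classical in
/-- Indicator (with values in `ℝ≥0∞`) of the event that `|x k| > s`. -/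
def exIndGT (s : ℝ) (k : Fin d → ℤ) (x : RField d) : ℝ≥0∞ := if s < |x k| then 1 else 0

/-- The tail-process identity:
`E[h(θ_k Y) 1{|Y_k| > 1}] = E[h(Y) 1{|Y_{−k}| > 1}]` for every measurable nonnegative `h`
and every `k ∈ ℤ^d`. -/
def TailIdentity {Ω : Type*} [MeasurableSpace Ω] (μ : Measure Ω) (Y : Ω → RField d) : Prop :=
  ∀ h : RField d → ℝ≥0∞, Measurable h → ∀ k : Fin d → ℤ,
    ∫⁻ ω, h (shift k (Y ω)) * exIndGT 1 k (Y ω) ∂μ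
      = ∫⁻ ω, h (Y ω) * exIndGT 1 (-k) (Y ω) ∂μ

/-- `Y` is exceedance-stationary: for every exceedance-map `τ` which is bijective on a
measurable set `B` (invariant under shifting the origin to exceedance-points, contained in
`ℝ₀^{ℤ^d}`) carrying the law of `Y`, we have `θ_τ Y ≐ Y`. -/
def ExcStationary {Ω : Type*} [MeasurableSpace Ω] (μ : Measure Ω) (Y : Ω → RField d) : Prop :=
  ∀ (B : Set (RField d)) (τ : RField d → Fin d → ℤ),
    MeasurableSet B → Measurable τ →
    (∀ x ∈ B, 1 < |x 0|) →
    (∀ x ∈ B, ∀ k ∈ excSet x, shift k x ∈ B) →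
    (∀ x ∈ B, τ x ∈ excSet x) →
    (∀ x ∈ B, Set.BijOn (fun k => k + τ (shift k x)) (excSet x) (excSet x)) →
    (∀ᵐ ω ∂μ, Y ω ∈ B) →
    Measure.map (fun ω => shift (τ (Y ω)) (Y ω)) μ = Measure.map Y μ

/-- `E₀`: elements of `ℝ₀^{ℤ^d}` with finitely many exceedance-points. -/
def E0set (d : ℕ) : Set (RField d) := {x | 1 < |x 0| ∧ (excSet x).Finite}

/-- `E`: elements of `ℝ^{ℤ^d}` with at least one but finitely many exceedance-points. -/
def Eset (d : ℕ) : Set (RField d) := {x | (excSet x).Nonempty ∧ (excSet x).Finite}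

/-- `l₀`: fields vanishing at infinity. -/
def l0set (d : ℕ) : Set (RField d) := {x | Tendsto (fun i => |x i|) cofinite (nhds 0)}

/-- Uniform norm `‖x‖ = sup_i |x_i|`. -/
def supNorm (x : RField d) : ℝ := ⨆ i, |x i|

/-- `V` is Pareto(α)-distributed: `P(V > y) = y^{-α}` for `y ≥ 1`. -/
def IsPareto {Ω : Type*} [MeasurableSpace Ω] (μ : Measure Ω) (V : Ω → ℝ) (α : ℝ) : Prop :=
  ∀ y : ℝ, 1 ≤ y → μ {ω | y < V ω} = ENNReal.ofReal (y ^ (-α))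

/-- An anchoring function on `S`: a measurable shift-covariant exceedance-map. -/
def IsAnchoringOn (S : Set (RField d)) (A : RField d → Fin d → ℤ) : Prop :=
  Measurable A ∧ ∀ x ∈ S, A x ∈ excSet x ∧ ∀ k ∈ excSet x, A (shift k x) + k = A x

/-- `h` is shift-invariant on `S`. -/
def ShiftInvariantOn (S : Set (RField d)) (h : RField d → ℝ≥0∞) : Prop :=
  ∀ x ∈ S, ∀ k : Fin d → ℤ, h (shift k x) = h x

/-- Data of a first-maximum anchoring function `A^{fm}`: a translation-invariant linear
(group) order `r` on `ℤ^d`, and a measurable map `Afm` which picks, for every nonzero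
`x ∈ l₀`, the `r`-smallest index at which `|x|` attains its maximum `‖x‖`. -/
structure FirstMaxData (d : ℕ) where
  r : (Fin d → ℤ) → (Fin d → ℤ) → Prop
  Afm : RField d → Fin d → ℤ
  r_linear : IsLinearOrder (Fin d → ℤ) r
  r_add_invariant : ∀ a b c : Fin d → ℤ, r a b → r (a + c) (b + c)
  meas : Measurable Afm
  mem_argmax : ∀ x ∈ l0set d, x ≠ 0 → |x (Afm x)| = supNorm x
  min_argmax : ∀ x ∈ l0set d, x ≠ 0 → ∀ k : Fin d → ℤ, |x k| = supNorm x → r (Afm x) k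

/-- `Q` (a random element of `l₀` on `(Ω₂, μ₂)`) is a representative of the anchored spectral
tail process of `Θ`: `E[h(Q)] = E[h(Θ) | A^{fm}(Θ) = 0]` for every shift-invariant
measurable `h : l₀ → [0,∞)`. -/
def IsSpectralRep {Ω : Type*} [MeasurableSpace Ω] (μ : Measure Ω) (Θ : Ω → RField d)
    (F : FirstMaxData d) {Ω₂ : Type*} [MeasurableSpace Ω₂] (μ₂ : Measure Ω₂)
    (Q : Ω₂ → RField d) : Prop :=
  ∀ h : RField d → ℝ≥0∞, Measurable h → ShiftInvariantOn (l0set d) h →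
    ∫⁻ ω, h (Q ω) ∂μ₂
      = ∫⁻ x, h x ∂(ProbabilityTheory.cond (Measure.map Θ μ) {x | F.Afm x = 0})

/-- The field shifted to `k` and normalised by its modulus there. -/
def normShift (k : Fin d → ℤ) (x : RField d) : RField d := |x k|⁻¹ • shift k x

lemma measurable_shift (k : Fin d → ℤ) : Measurable (shift k : RField d → RField d) :=
  measurable_pi_lambda _ fun i => measurable_pi_apply (i + k)

lemma measurable_normShift (k : Fin d → ℤ) :
    Measurable (normShift k : RField d → RField d) :=
  measurable_pi_lambda _ fun i =>
    ((measurable_pi_apply (X := fun _ : Fin d → ℤ => ℝ) k).abs.inv).mul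
      (measurable_pi_apply (i + k))

lemma measurable_exIndGT (s : ℝ) (k : Fin d → ℤ) :
    Measurable (exIndGT s k : RField d → ℝ≥0∞) := by
  classical
  unfold exIndGT
  exact Measurable.ite (measurableSet_lt measurable_const
    (measurable_pi_apply (X := fun _ : Fin d → ℤ => ℝ) k).abs) measurable_const measurable_const

lemma normShift_shift (j k : Fin d → ℤ) (x : RField d) :
    normShift j (shift k x) = normShift (j + k) x := by
  ext i
  simp [normShift, shift, add_assoc]

lemma shift_smul (c : ℝ) (k : Fin d → ℤ) (x : RField d) :
    shift k (c • x) = c • shift k x := rfl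

lemma normShift_smul {c : ℝ} (hc : 0 < c) (k : Fin d → ℤ) (x : RField d) :
    normShift k (c • x) = normShift k x := by
  ext i
  simp only [normShift, shift, Pi.smul_apply, smul_eq_mul, abs_mul, abs_of_pos hc, mul_inv]
  field_simp

lemma supNorm_shift (k : Fin d → ℤ) (x : RField d) : supNorm (shift k x) = supNorm x :=
  (Equiv.addRight k).iSup_comp (g := fun i => |x i|)

lemma supNorm_smul {c : ℝ} (hc : 0 < c) (x : RField d) : supNorm (c • x) = c * supNorm x := by
  simp only [supNorm, Real.mul_iSup_of_nonneg hc.le, Pi.smul_apply, smul_eq_mul, abs_mul,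
    abs_of_pos hc]

lemma shift_mem_l0set {x : RField d} (hx : x ∈ l0set d) (k : Fin d → ℤ) :
    shift k x ∈ l0set d :=
  Tendsto.comp (g := fun i => |x i|) hx (Equiv.addRight k).injective.tendsto_cofinite

lemma smul_mem_l0set {x : RField d} (hx : x ∈ l0set d) (c : ℝ) : c • x ∈ l0set d := by
  have h : Tendsto (fun i => |c| * |x i|) cofinite (nhds (|c| * 0)) :=
    Tendsto.const_mul |c| hx
  simpa [l0set, abs_mul] using h

lemma bddAbove_of_mem_l0set {x : RField d} (hx : x ∈ l0set d) :
    BddAbove (Set.range fun i => |x i|) :=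
  Tendsto.bddAbove_range_of_cofinite hx

lemma finite_excSet_of_mem_l0set {x : RField d} (hx : x ∈ l0set d) : (excSet x).Finite := by
  have h : ∀ᶠ i in cofinite, |x i| < 1 := Tendsto.eventually_lt_const one_pos hx
  exact Set.Finite.subset h fun k (hk : 1 < |x k|) => by simpa using hk.le

lemma FirstMaxData.le_abs_apply (F : FirstMaxData d) {x : RField d} (hx : x ∈ l0set d)
    (hx0 : x ≠ 0) (k : Fin d → ℤ) : |x k| ≤ |x (F.Afm x)| := by
  rw [F.mem_argmax x hx hx0]
  exact le_ciSup (bddAbove_of_mem_l0set hx) k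

lemma FirstMaxData.Afm_eq (F : FirstMaxData d) {x : RField d} (hx : x ∈ l0set d)
    (hx0 : x ≠ 0) {j : Fin d → ℤ} (hj : |x j| = supNorm x)
    (hmin : ∀ k, |x k| = supNorm x → F.r j k) : F.Afm x = j :=
  F.r_linear.antisymm _ _ (F.min_argmax x hx hx0 j hj) (hmin _ (F.mem_argmax x hx hx0))

lemma FirstMaxData.Afm_smul (F : FirstMaxData d) {x : RField d} (hx : x ∈ l0set d)
    (hx0 : x ≠ 0) {c : ℝ} (hc : 0 < c) : F.Afm (c • x) = F.Afm x := by
  have key : ∀ k, |(c • x) k| = supNorm (c • x) ↔ |x k| = supNorm x := fun k => by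
    simp [supNorm_smul hc, abs_mul, abs_of_pos hc, hc.ne']
  exact F.Afm_eq (smul_mem_l0set hx c) (smul_ne_zero hc.ne' hx0)
    ((key _).2 (F.mem_argmax x hx hx0)) fun k hk => F.min_argmax x hx hx0 k ((key k).1 hk)

lemma FirstMaxData.Afm_shift (F : FirstMaxData d) {x : RField d} (hx : x ∈ l0set d)
    (hx0 : x ≠ 0) (k : Fin d → ℤ) : F.Afm (shift k x) = F.Afm x - k := by
  have hs0 : shift k x ≠ 0 := fun h => hx0 <| funext fun i => by
    simpa [shift] using congrFun h (i - k)
  refine F.Afm_eq (shift_mem_l0set hx k) hs0 ?_ fun j hj => ?_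
  · simpa [supNorm_shift, shift] using F.mem_argmax x hx hx0
  · rw [supNorm_shift] at hj
    simpa [sub_eq_add_neg] using F.r_add_invariant _ _ (-k) (F.min_argmax x hx hx0 _ hj)

lemma FirstMaxData.Afm_normShift (F : FirstMaxData d) {x : RField d} (hx : x ∈ l0set d)
    {k : Fin d → ℤ} (hk : x k ≠ 0) : F.Afm (normShift k x) = F.Afm x - k := by
  have hx0 : x ≠ 0 := fun h => hk (congrFun h k)
  have hs0 : shift k x ≠ 0 := fun h => hk <| by simpa [shift] using congrFun h 0
  rw [normShift, F.Afm_smul (shift_mem_l0set hx k) hs0 (inv_pos.2 (abs_pos.2 hk)),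
    F.Afm_shift hx hx0]

lemma tsum_exIndGT_one (x : RField d) :
    ∑' k, exIndGT 1 k x = ((excSet x).encard : ℝ≥0∞) := by
  classical
  rw [← ENNReal.tsum_set_one, tsum_subtype (excSet x) fun _ => (1 : ℝ≥0∞)]
  exact tsum_congr fun k => by simp [exIndGT, excSet, Set.indicator_apply]

lemma measurable_inv_encard_excSet :
    Measurable fun x : RField d => ((excSet x).encard : ℝ≥0∞)⁻¹ := by
  simp only [← tsum_exIndGT_one]
  exact (Measurable.tsum fun k => measurable_exIndGT 1 k).inv

lemma encard_excSet_shift (k : Fin d → ℤ) (x : RField d) :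
    ((excSet (shift k x)).encard : ℝ≥0∞) = (excSet x).encard := by
  rw [← tsum_exIndGT_one, ← tsum_exIndGT_one]
  exact (Equiv.addRight k).tsum_eq fun j => exIndGT 1 j x

section Independence

variable {Ω : Type*} [MeasurableSpace Ω] {μ : Measure Ω}

lemma lintegral_mul_indicator_of_indepFun [IsProbabilityMeasure μ] {β : Type*}
    [MeasurableSpace β] {R : Ω → ℝ} {X : Ω → β} (hR : Measurable R) (hX : Measurable X)
    (hind : IndepFun R X μ) {g : β → ℝ≥0∞} (hg : Measurable g) {S : Set (ℝ × β)}
    (hS : MeasurableSet S) :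
    ∫⁻ ω, g (X ω) * S.indicator 1 (R ω, X ω) ∂μ
      = ∫⁻ ω, g (X ω) * μ {ω' | (R ω', X ω) ∈ S} ∂μ := by
  have := Measure.isProbabilityMeasure_map (μ := μ) hR.aemeasurable
  have := Measure.isProbabilityMeasure_map (μ := μ) hX.aemeasurable
  have hf : Measurable fun p : ℝ × β => g p.2 * S.indicator 1 p :=
    (hg.comp measurable_snd).mul (measurable_one.indicator hS)
  have h := (indepFun_iff_map_prod_eq_prod_map_map hR.aemeasurable hX.aemeasurable).1 hind
  have hslice : ∀ y : β, ∫⁻ r, g y * S.indicator 1 (r, y) ∂(μ.map R)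
      = g y * μ {ω' | (R ω', y) ∈ S} := fun y => by
    have hSy : MeasurableSet {r : ℝ | (r, y) ∈ S} := measurable_prodMk_right hS
    refine (lintegral_const_mul _
      ((measurable_one.indicator hS).comp measurable_prodMk_right)).trans ?_
    congr 1
    calc ∫⁻ r, S.indicator 1 (r, y) ∂(μ.map R)
        = ∫⁻ r, {r : ℝ | (r, y) ∈ S}.indicator 1 r ∂(μ.map R) := rfl
      _ = μ {ω' | (R ω', y) ∈ S} := by
        rw [lintegral_indicator_one hSy, Measure.map_apply hR hSy]; rfl
  calc ∫⁻ ω, g (X ω) * S.indicator 1 (R ω, X ω) ∂μ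
      = ∫⁻ p, g p.2 * S.indicator 1 p ∂(μ.map fun ω => (R ω, X ω)) :=
        (lintegral_map hf (hR.prodMk hX)).symm
    _ = ∫⁻ y, ∫⁻ r, g y * S.indicator 1 (r, y) ∂(μ.map R) ∂(μ.map X) := by
        rw [h, lintegral_prod_symm' _ hf]
    _ = ∫⁻ ω, ∫⁻ r, g (X ω) * S.indicator 1 (r, X ω) ∂(μ.map R) ∂μ :=
        lintegral_map hf.lintegral_prod_left' hX
    _ = _ := lintegral_congr fun ω => hslice (X ω)

lemma IsPareto.measure_gt [IsProbabilityMeasure μ] {V : Ω → ℝ} {α : ℝ} (hV : IsPareto μ V α)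
    (hα : 0 < α) {c : ℝ} (hc : 0 < c) :
    μ {ω | c < V ω} = ENNReal.ofReal (min 1 (c ^ (-α))) := by
  rcases le_total 1 c with h | h
  · rw [hV c h, min_eq_right (Real.rpow_le_one_of_one_le_of_nonpos h (by linarith))]
  · rw [min_eq_left (Real.one_le_rpow_of_pos_of_le_one_of_nonpos hc h (by linarith)),
      ENNReal.ofReal_one]
    refine le_antisymm prob_le_one ?_
    calc (1 : ℝ≥0∞) = μ {ω | 1 < V ω} := by simp [hV 1 le_rfl]
      _ ≤ _ := measure_mono fun ω (hω : 1 < V ω) => h.trans_lt hω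

lemma IsPareto.ae_one_lt [IsProbabilityMeasure μ] {V : Ω → ℝ} {α : ℝ} (hV : IsPareto μ V α)
    (hVm : Measurable V) : ∀ᵐ ω ∂μ, 1 < V ω := by
  have h : μ {ω | 1 < V ω} = 1 := by simpa using hV 1 le_rfl
  rw [← prob_compl_eq_zero_iff (measurableSet_lt measurable_const hVm)] at h
  exact h

lemma IsPareto.ofReal_mul_measure_lt_mul [IsProbabilityMeasure μ] {V : Ω → ℝ} {α : ℝ}
    (hV : IsPareto μ V α) (hα : 0 < α) {s u : ℝ} (hs : 0 < s) (hu : 0 ≤ u) :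
    ENNReal.ofReal (s ^ α) * μ {ω | s < V ω * u} = ENNReal.ofReal (min (s ^ α) (u ^ α)) := by
  have hsα := Real.rpow_pos_of_pos hs α
  rcases hu.eq_or_lt with rfl | hu
  · simp [not_lt.2 hs.le, Real.zero_rpow hα.ne', hsα.le]
  · simp only [← div_lt_iff₀ hu]
    rw [hV.measure_gt hα (div_pos hs hu), ← ENNReal.ofReal_mul hsα.le,
      mul_min_of_nonneg _ _ hsα.le, mul_one, Real.rpow_neg (div_pos hs hu).le,
      Real.div_rpow hs.le hu.le]
    congr 2
    field_simp

lemma IsPareto.ofReal_mul_measure_lt_and [IsProbabilityMeasure μ] {V : Ω → ℝ} {α : ℝ}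
    (hV : IsPareto μ V α) (hα : 0 < α) {s u : ℝ} (hs : 1 ≤ s) (hu : 0 ≤ u) :
    ENNReal.ofReal (s ^ α) * μ {ω | s < V ω ∧ 1 < V ω * u}
      = ENNReal.ofReal (min 1 ((s * u) ^ α)) := by
  have hs0 : 0 < s := by linarith
  have hsα := Real.rpow_pos_of_pos hs0 α
  rcases hu.eq_or_lt with rfl | hu
  · simp [not_lt.2, Real.zero_rpow hα.ne']
  · have hm : 1 ≤ max s (1 / u) := hs.trans (le_max_left _ _)
    simp only [← div_lt_iff₀ hu, ← max_lt_iff]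
    rw [hV _ hm, ← ENNReal.ofReal_mul hsα.le, Real.mul_rpow hs0.le hu.le]
    congr 1
    have hu' : 0 < 1 / u := by positivity
    rcases le_total s (1 / u) with h | h
    · rw [max_eq_right h, min_eq_right, one_div, Real.inv_rpow hu.le, Real.rpow_neg hu.le, inv_inv]
      rw [← Real.mul_rpow hs0.le hu.le]
      exact Real.rpow_le_one (by positivity) ((le_div_iff₀ hu).1 h) hα.le
    · rw [max_eq_left h, min_eq_left, Real.rpow_neg hs0.le, mul_inv_cancel₀ hsα.ne']
      rw [← Real.mul_rpow hs0.le hu.le]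
      exact Real.one_le_rpow ((div_le_iff₀ hu).1 h) hα.le

end Independence

section TailProcess

variable {Ω : Type*} [MeasurableSpace Ω] {μ : Measure Ω} {Y : Ω → RField d}

/-- The tail-process identity for functions of the normalised field, localised to the event
that the exceedance at `k` is larger than `s`. -/
lemma TailIdentity.lintegral_normShift (hTI : TailIdentity μ Y) {H : RField d → ℝ≥0∞}
    (hH : Measurable H) {s : ℝ} (hs : 1 ≤ s) (k : Fin d → ℤ) :
    ∫⁻ ω, H (normShift k (Y ω)) * exIndGT s k (Y ω) ∂μ
      = ∫⁻ ω, H (normShift 0 (Y ω)) * (exIndGT s 0 (Y ω) * exIndGT 1 (-k) (Y ω)) ∂μ := by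
  classical
  have h := hTI (fun x => H (normShift 0 x) * exIndGT s 0 x)
    ((hH.comp (measurable_normShift 0)).mul (measurable_exIndGT s 0)) k
  simp only [normShift_shift, zero_add, mul_assoc] at h
  rw [← h]
  refine lintegral_congr fun ω => ?_
  congr 1
  by_cases h1 : s < |Y ω k|
  · simp [exIndGT, shift, h1, hs.trans_lt h1]
  · simp [exIndGT, shift, h1]

/-- The time-change formula for the spectral process of a tail process. -/
lemma TailIdentity.time_change [IsProbabilityMeasure μ] (hY : Measurable Y)
    (hTI : TailIdentity μ Y) {α : ℝ} (hα : 0 < α) (hPar : IsPareto μ (fun ω => |Y ω 0|) α)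
    {Θ : Ω → RField d} (hΘ : ∀ ω, Θ ω = normShift 0 (Y ω))
    (hind : IndepFun (fun ω => |Y ω 0|) Θ μ) {H : RField d → ℝ≥0∞} (hH : Measurable H)
    (k : Fin d → ℤ) :
    ∫⁻ ω, H (normShift k (Θ ω)) * ENNReal.ofReal (|Θ ω k| ^ α) ∂μ
      = ∫⁻ ω, H (Θ ω) * (if Θ ω (-k) = 0 then 0 else 1) ∂μ := by
  have happ : ∀ j : Fin d → ℤ, Measurable fun x : RField d => |x j| := fun j =>
    (measurable_pi_apply (X := fun _ : Fin d → ℤ => ℝ) j).abs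
  have hΘm : Measurable Θ := by
    rw [show Θ = normShift 0 ∘ Y from funext hΘ]
    exact (measurable_normShift 0).comp hY
  have hRm : Measurable fun ω => |Y ω 0| := (happ 0).comp hY
  have hRpos : ∀ᵐ ω ∂μ, 0 < |Y ω 0| := (hPar.ae_one_lt hRm).mono fun ω h => one_pos.trans h
  have hYΘ : ∀ ω, 0 < |Y ω 0| → Y ω = |Y ω 0| • Θ ω := fun ω h => by
    ext i
    simp only [hΘ, normShift, shift, Pi.smul_apply, smul_eq_mul, add_zero]
    field_simp
  have hYabs : ∀ ω, 0 < |Y ω 0| → ∀ j, |Y ω j| = |Y ω 0| * |Θ ω j| := fun ω h j => by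
    conv_lhs => rw [hYΘ ω h]
    rw [Pi.smul_apply, smul_eq_mul, abs_mul, abs_abs]
  have key : ∀ s : ℝ, 1 ≤ s →
      ∫⁻ ω, H (normShift k (Θ ω)) * ENNReal.ofReal (min (s ^ α) (|Θ ω k| ^ α)) ∂μ
        = ∫⁻ ω, H (Θ ω) * ENNReal.ofReal (min 1 ((s * |Θ ω (-k)|) ^ α)) ∂μ := by
    intro s hs
    have hs0 : 0 < s := by linarith
    let S : Set (ℝ × RField d) := {p | s < p.1 * |p.2 k|}
    let T : Set (ℝ × RField d) := {p | s < p.1 ∧ 1 < p.1 * |p.2 (-k)|}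
    have hS : MeasurableSet S :=
      measurableSet_lt measurable_const (measurable_fst.mul ((happ k).comp measurable_snd))
    have hT : MeasurableSet T :=
      (measurableSet_lt measurable_const measurable_fst).inter (measurableSet_lt measurable_const
        (measurable_fst.mul ((happ (-k)).comp measurable_snd)))
    have hHk : Measurable fun x => H (normShift k x) := hH.comp (measurable_normShift k)
    have hleft : ∫⁻ ω, H (normShift k (Y ω)) * exIndGT s k (Y ω) ∂μ
        = ∫⁻ ω, H (normShift k (Θ ω)) * S.indicator 1 (|Y ω 0|, Θ ω) ∂μ := by
      refine lintegral_congr_ae (hRpos.mono fun ω hω => ?_)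
      have h1 : normShift k (Y ω) = normShift k (Θ ω) := by
        conv_lhs => rw [hYΘ ω hω, normShift_smul hω]
      beta_reduce
      rw [h1, exIndGT, hYabs ω hω k]
      rfl
    have hright : ∫⁻ ω, H (normShift 0 (Y ω)) * (exIndGT s 0 (Y ω) * exIndGT 1 (-k) (Y ω)) ∂μ
        = ∫⁻ ω, H (Θ ω) * T.indicator 1 (|Y ω 0|, Θ ω) ∂μ := by
      refine lintegral_congr_ae (hRpos.mono fun ω hω => ?_)
      beta_reduce
      rw [← hΘ ω]
      congr 1
      rw [exIndGT, exIndGT, hYabs ω hω (-k)]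
      by_cases h1 : s < |Y ω 0| <;> by_cases h2 : 1 < |Y ω 0| * |Θ ω (-k)| <;>
        simp [T, h1, h2]
    have h := hTI.lintegral_normShift hH hs k
    rw [hleft, hright, lintegral_mul_indicator_of_indepFun hRm hΘm hind hHk hS,
      lintegral_mul_indicator_of_indepFun hRm hΘm hind hH hT] at h
    have h' := congrArg (fun a => ENNReal.ofReal (s ^ α) * a) h
    rw [← lintegral_const_mul' _ _ ENNReal.ofReal_ne_top,
      ← lintegral_const_mul' _ _ ENNReal.ofReal_ne_top] at h'
    refine Eq.trans (lintegral_congr fun ω => ?_) (h'.trans (lintegral_congr fun ω => ?_))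
    · rw [mul_left_comm, ← hPar.ofReal_mul_measure_lt_mul hα hs0 (abs_nonneg (Θ ω k))]
      rfl
    · rw [mul_left_comm, ← hPar.ofReal_mul_measure_lt_and hα hs (abs_nonneg (Θ ω (-k)))]
      rfl
  have hn : ∀ n : ℕ, (1 : ℝ) ≤ n + 1 := fun n => by simp
  have hmono : ∀ m n : ℕ, m ≤ n → (m : ℝ) + 1 ≤ n + 1 := fun m n h => by gcongr
  have hatTop : Tendsto (fun n : ℕ => (n : ℝ) + 1) atTop atTop :=
    tendsto_atTop_add_const_right _ _ tendsto_natCast_atTop_atTop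
  have hlim1 : Tendsto (fun n : ℕ => ∫⁻ ω, H (normShift k (Θ ω)) *
        ENNReal.ofReal (min (((n : ℝ) + 1) ^ α) (|Θ ω k| ^ α)) ∂μ) atTop
      (nhds (∫⁻ ω, H (normShift k (Θ ω)) * ENNReal.ofReal (|Θ ω k| ^ α) ∂μ)) := by
    refine lintegral_tendsto_of_tendsto_of_monotone (fun n => ?_)
      (ae_of_all _ fun ω m n hmn => ?_) (ae_of_all _ fun ω => ?_)
    · refine ((hH.comp (measurable_normShift k)).comp hΘm |>.mul ?_).aemeasurable
      exact (measurable_const.min (((happ k).comp hΘm).pow_const α)).ennreal_ofReal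
    · have := hmono m n hmn
      dsimp only
      gcongr
    · refine tendsto_nhds_of_eventually_eq ?_
      filter_upwards [hatTop.eventually_ge_atTop |Θ ω k|] with n h
      rw [min_eq_right (Real.rpow_le_rpow (abs_nonneg _) h hα.le)]
  have hlim2 : Tendsto (fun n : ℕ => ∫⁻ ω, H (Θ ω) *
        ENNReal.ofReal (min 1 ((((n : ℝ) + 1) * |Θ ω (-k)|) ^ α)) ∂μ) atTop
      (nhds (∫⁻ ω, H (Θ ω) * (if Θ ω (-k) = 0 then 0 else 1) ∂μ)) := by
    refine lintegral_tendsto_of_tendsto_of_monotone (fun n => ?_)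
      (ae_of_all _ fun ω m n hmn => ?_) (ae_of_all _ fun ω => ?_)
    · refine ((hH.comp hΘm).mul ?_).aemeasurable
      exact (measurable_const.min
        ((((happ (-k)).comp hΘm).const_mul _).pow_const α)).ennreal_ofReal
    · have := hmono m n hmn
      dsimp only
      gcongr
    · refine tendsto_nhds_of_eventually_eq ?_
      by_cases h0 : Θ ω (-k) = 0
      · simp [h0, Real.zero_rpow hα.ne']
      · have hpos : 0 < |Θ ω (-k)| := abs_pos.2 h0
        filter_upwards [hatTop.eventually_ge_atTop (1 / |Θ ω (-k)|)] with n h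
        rw [min_eq_left (Real.one_le_rpow ((div_le_iff₀ hpos).1 h) hα.le)]
        simp [h0]
  refine tendsto_nhds_unique hlim1 (hlim2.congr fun n => (key _ (hn n)).symm)

lemma tsum_lintegral_mul_indicator_singleton {ι : Type*} [Countable ι] [MeasurableSpace ι]
    [MeasurableSingletonClass ι] {N : Ω → ι} (hN : Measurable N) {f : Ω → ℝ≥0∞}
    (hf : Measurable f) :
    ∑' i, ∫⁻ ω, f ω * ({i} : Set ι).indicator 1 (N ω) ∂μ = ∫⁻ ω, f ω ∂μ := by
  refine (lintegral_tsum fun i => (hf.mul ((measurable_one.indicator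
    (measurableSet_singleton i)).comp hN)).aemeasurable).symm.trans
    (lintegral_congr fun ω => ?_)
  simp only [Pi.mul_apply, Function.comp_apply]
  rw [ENNReal.tsum_mul_left, tsum_eq_single (N ω) fun i hi => by simp [hi.symm]]
  simp

/-- The candidate extremal index `E[1/|e(Y)|]` is the probability that the first maximum is
attained at the origin. -/
lemma TailIdentity.lintegral_inv_encard (hY : Measurable Y) (hTI : TailIdentity μ Y)
    (F : FirstMaxData d) (hY0 : ∀ᵐ ω ∂μ, 1 < |Y ω 0|) (hYl0 : ∀ᵐ ω ∂μ, Y ω ∈ l0set d) :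
    ∫⁻ ω, ((excSet (Y ω)).encard : ℝ≥0∞)⁻¹ ∂μ = μ {ω | F.Afm (Y ω) = 0} := by
  classical
  let h : RField d → ℝ≥0∞ := fun x =>
    ((excSet x).encard : ℝ≥0∞)⁻¹ * ({0} : Set (Fin d → ℤ)).indicator 1 (F.Afm x)
  have hA0 : Measurable fun x : RField d => ({0} : Set (Fin d → ℤ)).indicator
      (1 : (Fin d → ℤ) → ℝ≥0∞) (F.Afm x) :=
    (measurable_one.indicator (measurableSet_singleton 0)).comp F.meas
  have hh : Measurable h := measurable_inv_encard_excSet.mul hA0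
  refine (tsum_lintegral_mul_indicator_singleton (F.meas.comp hY)
    (measurable_inv_encard_excSet.comp hY)).symm.trans ?_
  calc ∑' k, ∫⁻ ω, ((excSet (Y ω)).encard : ℝ≥0∞)⁻¹ *
          ({k} : Set (Fin d → ℤ)).indicator 1 (F.Afm (Y ω)) ∂μ
      = ∑' k, ∫⁻ ω, h (shift k (Y ω)) * exIndGT 1 k (Y ω) ∂μ := by
        refine tsum_congr fun k => lintegral_congr_ae ?_
        filter_upwards [hY0, hYl0] with ω h0 hl
        have hne : Y ω ≠ 0 := fun h => by simp [h] at h0; linarith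
        simp only [h, encard_excSet_shift, F.Afm_shift hl hne, mul_assoc]
        congr 1
        by_cases hk : F.Afm (Y ω) = k
        · have : 1 < |Y ω k| := hk ▸ h0.trans_le (F.le_abs_apply hl hne 0)
          simp [hk, exIndGT, this]
        · simp [hk, sub_eq_zero]
    _ = ∑' k, ∫⁻ ω, h (Y ω) * exIndGT 1 (-k) (Y ω) ∂μ := tsum_congr fun k => hTI h hh k
    _ = ∫⁻ ω, ∑' k, h (Y ω) * exIndGT 1 (-k) (Y ω) ∂μ :=
        (lintegral_tsum fun k =>
          ((hh.comp hY).mul ((measurable_exIndGT 1 (-k)).comp hY)).aemeasurable).symm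
    _ = ∫⁻ ω, {ω | F.Afm (Y ω) = 0}.indicator 1 ω ∂μ := by
        refine lintegral_congr_ae ?_
        filter_upwards [hY0, hYl0] with ω h0 hl
        have hsum : ∑' k, exIndGT 1 (-k) (Y ω) = ((excSet (Y ω)).encard : ℝ≥0∞) := by
          rw [← tsum_exIndGT_one]
          exact (Equiv.neg (Fin d → ℤ)).tsum_eq fun k => exIndGT 1 k (Y ω)
        have hne0 : ((excSet (Y ω)).encard : ℝ≥0∞) ≠ 0 := by
          have : (excSet (Y ω)).Nonempty := ⟨0, h0⟩
          simpa using this.ne_empty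
        have hnetop : ((excSet (Y ω)).encard : ℝ≥0∞) ≠ ∞ := by
          simpa using finite_excSet_of_mem_l0set hl
        rw [ENNReal.tsum_mul_left, hsum]
        simp only [h]
        rw [mul_right_comm, ENNReal.inv_mul_cancel hne0 hnetop, one_mul]
        rfl
    _ = μ {ω | F.Afm (Y ω) = 0} :=
        lintegral_indicator_one ((F.meas.comp hY) (measurableSet_singleton 0))

end TailProcess

/-- The sum `Σ_k |x_k|^α h(θ_k x / |x_k|)`. -/
def palmSum (α : ℝ) (h : RField d → ℝ≥0∞) (x : RField d) : ℝ≥0∞ :=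
  ∑' k, h (normShift k x) * ENNReal.ofReal (|x k| ^ α)

lemma measurable_ofReal_abs_rpow (α : ℝ) (k : Fin d → ℤ) :
    Measurable fun x : RField d => ENNReal.ofReal (|x k| ^ α) :=
  ((measurable_pi_apply (X := fun _ : Fin d → ℤ => ℝ) k).abs.pow_const α).ennreal_ofReal

lemma measurable_palmSum (α : ℝ) {h : RField d → ℝ≥0∞} (hh : Measurable h) :
    Measurable (palmSum α h) :=
  Measurable.tsum fun k =>
    (hh.comp (measurable_normShift k)).mul (measurable_ofReal_abs_rpow α k)

lemma palmSum_shift (α : ℝ) (h : RField d → ℝ≥0∞) (j : Fin d → ℤ) (x : RField d) :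
    palmSum α h (shift j x) = palmSum α h x := by
  simp only [palmSum, normShift_shift]
  exact (Equiv.addRight j).tsum_eq fun k => h (normShift k x) * ENNReal.ofReal (|x k| ^ α)

open Classical in
/-- **spectral Palm inversion.** Let `Y` be a tail process of index `α > 0`
with finitely many exceedance-points, `Θ = Y/|Y_0|` its spectral process, `ϑ = E[1/|e(Y)|]`,
and let `Q` be any representative of the anchored spectral tail process. Then for all
measurable `h ≥ 0`: `E[h(Θ)] = ϑ E[Σ_k h(θ_k Q/|Q_k|) |Q_k|^α]` (summands with `Q_k = 0`
vanish). -/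
theorem spectral_palm_inversion
    {Ω : Type*} [MeasurableSpace Ω] (μ : Measure Ω) [IsProbabilityMeasure μ]
    {Ω₂ : Type*} [MeasurableSpace Ω₂] (μ₂ : Measure Ω₂) [IsProbabilityMeasure μ₂]
    (Y : Ω → RField d) (hY : Measurable Y) (hTI : TailIdentity μ Y)
    (α : ℝ) (hα : 0 < α) (hPar : IsPareto μ (fun ω => |Y ω 0|) α)
    (Θ : Ω → RField d) (hΘdef : Θ = fun ω => fun i => Y ω i / |Y ω 0|)
    (hind : IndepFun (fun ω => |Y ω 0|) Θ μ)
    (hl0 : ∀ᵐ ω ∂μ, Θ ω ∈ l0set d)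
    (ϑ : ℝ≥0∞) (hϑ : ϑ = ∫⁻ ω, ((excSet (Y ω)).encard)⁻¹ ∂μ)
    (F : FirstMaxData d)
    (Q : Ω₂ → RField d) (hQ : Measurable Q) (hQl0 : ∀ᵐ ω ∂μ₂, Q ω ∈ l0set d)
    (hrep : IsSpectralRep μ Θ F μ₂ Q) :
    ∀ h : RField d → ℝ≥0∞, Measurable h →
      ∫⁻ ω, h (Θ ω) ∂μ
        = ϑ * ∫⁻ ω, ∑' k : Fin d → ℤ,
            (if Q ω k = 0 then 0
              else ENNReal.ofReal (|Q ω k| ^ α) * h (|Q ω k|⁻¹ • shift k (Q ω))) ∂μ₂ := by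
  intro h hh
  have hΘ : ∀ ω, Θ ω = normShift 0 (Y ω) := fun ω => by
    ext i
    simp [hΘdef, normShift, shift, div_eq_inv_mul]
  have hΘm : Measurable Θ := by
    rw [show Θ = normShift 0 ∘ Y from funext hΘ]
    exact (measurable_normShift 0).comp hY
  have hY0 : ∀ᵐ ω ∂μ, 1 < |Y ω 0| :=
    hPar.ae_one_lt ((measurable_pi_apply (X := fun _ : Fin d → ℤ => ℝ) 0).comp hY).abs
  have hYΘ : ∀ᵐ ω ∂μ, Y ω = |Y ω 0| • Θ ω := hY0.mono fun ω h0 => by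
    have : |Y ω 0| ≠ 0 := by linarith
    ext i
    simp only [hΘdef, Pi.smul_apply, smul_eq_mul]
    field_simp
  have hYl0 : ∀ᵐ ω ∂μ, Y ω ∈ l0set d := by
    filter_upwards [hYΘ, hl0] with ω h1 h2
    rw [h1]
    exact smul_mem_l0set h2 _
  have hΘ0 : ∀ᵐ ω ∂μ, |Θ ω 0| = 1 := hY0.mono fun ω h0 => by
    have : |Y ω 0| ≠ 0 := by linarith
    simp [hΘdef, abs_div, this]
  have hne : ∀ ω, |Θ ω 0| = 1 → Θ ω ≠ 0 := fun ω h1 h0 => by simp [h0] at h1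
  have hAmeas : MeasurableSet {x : RField d | F.Afm x = 0} := F.meas (measurableSet_singleton 0)
  have hϑA : ϑ = μ.map Θ {x | F.Afm x = 0} := by
    rw [hϑ, hTI.lintegral_inv_encard hY F hY0 hYl0, Measure.map_apply hΘm hAmeas]
    refine measure_congr ?_
    filter_upwards [hY0, hYΘ, hl0, hΘ0] with ω h0 h1 h2 h3
    have : F.Afm (Y ω) = F.Afm (Θ ω) := by
      conv_lhs => rw [h1, F.Afm_smul h2 (hne ω h3) (one_pos.trans h0)]
    exact congrArg (· = 0) this
  have hpalm : ∫⁻ ω, palmSum α h (Q ω) ∂μ₂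
      = ϑ⁻¹ * ∫⁻ x in {x | F.Afm x = 0}, palmSum α h x ∂(μ.map Θ) := by
    rw [hrep _ (measurable_palmSum α hh) fun x _ k => palmSum_shift α h k x,
      ProbabilityTheory.cond, lintegral_smul_measure, hϑA, smul_eq_mul]
  have hϑ0 : ϑ ≠ 0 := fun h0 => by
    have h1 := hrep 1 measurable_one fun _ _ _ => rfl
    have h2 : (μ.map Θ).restrict {x | F.Afm x = 0} = 0 := by
      rw [Measure.restrict_eq_zero, ← hϑA, h0]
    simp [ProbabilityTheory.cond, h2] at h1
  have hϑtop : ϑ ≠ ∞ := by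
    have := Measure.isProbabilityMeasure_map (μ := μ) hΘm.aemeasurable
    rw [hϑA]
    exact measure_ne_top _ _
  have hsum : ∫⁻ x in {x | F.Afm x = 0}, palmSum α h x ∂(μ.map Θ) = ∫⁻ ω, h (Θ ω) ∂μ := by
    have hind' : ∀ k : Fin d → ℤ, Measurable fun x : RField d =>
        h x * ({-k} : Set (Fin d → ℤ)).indicator 1 (F.Afm x) := fun k =>
      hh.mul ((measurable_one.indicator (measurableSet_singleton (-k))).comp F.meas)
    calc ∫⁻ x in {x | F.Afm x = 0}, palmSum α h x ∂(μ.map Θ)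
        = ∫⁻ ω, {x | F.Afm x = 0}.indicator (palmSum α h) (Θ ω) ∂μ := by
          rw [← lintegral_indicator hAmeas,
            lintegral_map ((measurable_palmSum α hh).indicator hAmeas) hΘm]
      _ = ∫⁻ ω, ∑' k, (h (normShift k (Θ ω)) * ({-k} : Set (Fin d → ℤ)).indicator 1
            (F.Afm (normShift k (Θ ω)))) * ENNReal.ofReal (|Θ ω k| ^ α) ∂μ := by
          refine lintegral_congr_ae ?_
          filter_upwards [hl0] with ω hl
          rw [show {x | F.Afm x = 0}.indicator (palmSum α h) (Θ ω) = palmSum α h (Θ ω) *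
            ({0} : Set (Fin d → ℤ)).indicator 1 (F.Afm (Θ ω)) by simp [Set.indicator_apply],
            palmSum, ← ENNReal.tsum_mul_right]
          refine tsum_congr fun k => ?_
          by_cases hk : Θ ω k = 0
          · simp [hk, Real.zero_rpow hα.ne']
          · rw [F.Afm_normShift hl hk, mul_right_comm]
            congr 2
            simp [Set.indicator_apply, sub_eq_neg_self]
      _ = ∑' k, ∫⁻ ω, (h (Θ ω) * ({-k} : Set (Fin d → ℤ)).indicator 1 (F.Afm (Θ ω))) *
            (if Θ ω (-k) = 0 then 0 else 1) ∂μ := by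
          refine (lintegral_tsum fun k => (((hind' k).comp (measurable_normShift k)).mul
            (measurable_ofReal_abs_rpow α k) |>.comp hΘm).aemeasurable).trans ?_
          exact tsum_congr fun k => hTI.time_change hY hα hPar hΘ hind (hind' k) k
      _ = ∑' k, ∫⁻ ω, h (Θ ω) * ({-k} : Set (Fin d → ℤ)).indicator 1 (F.Afm (Θ ω)) ∂μ := by
          refine tsum_congr fun k => lintegral_congr_ae ?_
          filter_upwards [hl0, hΘ0] with ω hl h1
          by_cases hk : F.Afm (Θ ω) = -k
          · have hle := F.le_abs_apply hl (hne ω h1) 0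
            rw [h1, hk] at hle
            have : Θ ω (-k) ≠ 0 := fun h0 => by simp [h0] at hle; linarith
            simp [this]
          · simp [hk]
      _ = ∑' k, ∫⁻ ω, h (Θ ω) * ({k} : Set (Fin d → ℤ)).indicator 1 (F.Afm (Θ ω)) ∂μ :=
          (Equiv.neg (Fin d → ℤ)).tsum_eq fun k => ∫⁻ ω, h (Θ ω) *
            ({k} : Set (Fin d → ℤ)).indicator 1 (F.Afm (Θ ω)) ∂μ
      _ = ∫⁻ ω, h (Θ ω) ∂μ := tsum_lintegral_mul_indicator_singleton (F.meas.comp hΘm) (hh.comp hΘm)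
  have hgoal : ∀ ω, (∑' k : Fin d → ℤ, (if Q ω k = 0 then 0
      else ENNReal.ofReal (|Q ω k| ^ α) * h (|Q ω k|⁻¹ • shift k (Q ω))))
      = palmSum α h (Q ω) := fun ω => tsum_congr fun k => by
    split_ifs with hk
    · simp [hk, Real.zero_rpow hα.ne']
    · rw [mul_comm]; rfl
  simp only [hgoal]
  rw [hpalm, hsum, ← mul_assoc, ENNReal.mul_inv_cancel hϑ0 hϑtop, one_mul]
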